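/- arXiv:1410.0212 — 2 statements merged into one kernel-verified Lean document; each statement's English description precedes it below -/
import Mathlib

section
/- Let Γ be a finite abelian group and let χ : Γ → ℂ* be a group homomorphism. Then the sum over all g ∈ Γ with χ(g) ≠ 1 of χ(g)/(χ(g) − 1)² equals −(1/12)·|ker χ|·(|im χ|² − 1). -/
open scoped Classical

theorem sum_range_mul_sub_mul_pow_mul_sub_one_cube {R : Type*} [CommRing R] (a x : R) (m : ℕ) :
    (∑ k ∈ Finset.range m, (k : R) * (a - k) * x ^ k) * (x - 1) ^ 3 =
      a * (x - 1) * ((m - 1) * x ^ (m + 1) - m * x ^ m + x) -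
        ((m - 1) ^ 2 * x ^ (m + 2) - (2 * m ^ 2 - 2 * m - 1) * x ^ (m + 1) + m ^ 2 * x ^ m
          - x ^ 2 - x) := by
  induction m with
  | zero => simp
  | succ m ih =>
    rw [Finset.sum_range_succ, add_mul, ih]
    push_cast
    ring

theorem sum_range_mul_sub_mul_pow_of_pow_eq_one {K : Type*} [Field K] {x : K} {n : ℕ}
    (hx : x ≠ 1) (hn : x ^ n = 1) :
    ∑ k ∈ Finset.range n, (k : K) * (n - k) * x ^ k = 2 * n * (x / (x - 1) ^ 2) := by
  have h := sum_range_mul_sub_mul_pow_mul_sub_one_cube (n : K) x n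
  simp only [pow_add, hn] at h
  have hx' : x - 1 ≠ 0 := sub_ne_zero.mpr hx
  apply mul_right_cancel₀ (pow_ne_zero 3 hx')
  rw [h]
  field_simp
  ring

theorem sum_range_mul_sub {K : Type*} [Field K] [CharZero K] (a : K) (m : ℕ) :
    ∑ k ∈ Finset.range m, (k : K) * (a - k) =
      m * (m - 1) * (3 * a - 2 * m + 1) / 6 := by
  induction m with
  | zero => simp
  | succ m ih =>
    rw [Finset.sum_range_succ, ih]
    push_cast
    field_simp
    ring

theorem MonoidHom.card_range_dvd_of_pow_eq_one {G R : Type*} [Group G] [Finite G] [CommRing R]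
    [IsDomain R] (χ : G →* Rˣ) {k : ℕ} (h : ∀ g, χ g ^ k = 1) : Nat.card χ.range ∣ k := by
  have : Finite χ.range := Finite.of_surjective _ χ.rangeRestrict_surjective
  rw [← IsCyclic.exponent_eq_card]
  refine Monoid.exponent_dvd_of_forall_pow_eq_one ?_
  rintro ⟨_, g, rfl⟩
  exact Subtype.ext (h g)

theorem MonoidHom.sum_pow_eq_zero {G R : Type*} [Group G] [Fintype G] [CommRing R]
    [IsDomain R] (χ : G →* Rˣ) {k : ℕ} (h : ¬ Nat.card χ.range ∣ k) :
    ∑ g, (χ g : R) ^ k = 0 := by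
  refine sum_hom_units_eq_zero ((powMonoidHom k).comp ((Units.coeHom R).comp χ)) fun h1 => h ?_
  exact χ.card_range_dvd_of_pow_eq_one fun g => Units.ext (by simpa using DFunLike.congr_fun h1 g)

/-- For a finite abelian group `Γ` and a character `χ : Γ → ℂ*`, the sum over all
`g ∈ Γ` with `χ(g) ≠ 1` of `χ(g)/(χ(g) - 1)²` equals `-(1/12)·|ker χ|·(|im χ|² - 1)`. -/
theorem character_dedekind_sum (Γ : Type*) [CommGroup Γ] [Fintype Γ] (χ : Γ →* ℂˣ) :
    ∑ g ∈ Finset.univ.filter (fun g : Γ => χ g ≠ 1),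
        (χ g : ℂ) / ((χ g : ℂ) - 1) ^ 2
      = -(1 / 12) * (Nat.card (MonoidHom.ker χ) : ℂ) *
          ((Nat.card (MonoidHom.range χ) : ℂ) ^ 2 - 1) := by
  have : Finite χ.range := Finite.of_surjective _ χ.rangeRestrict_surjective
  set n := Nat.card χ.range
  have hn0 : (n : ℂ) ≠ 0 := Nat.cast_ne_zero.mpr Nat.card_pos.ne'
  have hpow (g : Γ) : (χ g : ℂ) ^ n = 1 := by
    have h : χ.rangeRestrict g ^ n = 1 := pow_card_eq_one'
    simpa using congrArg (fun u : χ.range => ((u : ℂˣ) : ℂ)) h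
  have hker : ((Finset.univ.filter fun g : Γ => ¬ χ g ≠ 1).card : ℂ) = Nat.card χ.ker := by
    rw [← Nat.subtype_card (Finset.univ.filter fun g : Γ => ¬ χ g ≠ 1)
      (p := fun g => g ∈ χ.ker) (by simp [MonoidHom.mem_ker])]
  have hzero : ∑ g, ∑ k ∈ Finset.range n, (k : ℂ) * (n - k) * (χ g : ℂ) ^ k = 0 := by
    rw [Finset.sum_comm]
    refine Finset.sum_eq_zero fun k hk => ?_
    rw [← Finset.mul_sum]
    rcases Nat.eq_zero_or_pos k with rfl | hk0
    · simp
    · rw [χ.sum_pow_eq_zero (Nat.not_dvd_of_pos_of_lt hk0 (Finset.mem_range.mp hk)), mul_zero]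
  have hne : ∀ g ∈ Finset.univ.filter (fun g : Γ => χ g ≠ 1),
      ∑ k ∈ Finset.range n, (k : ℂ) * (n - k) * (χ g : ℂ) ^ k =
        2 * n * ((χ g : ℂ) / ((χ g : ℂ) - 1) ^ 2) := fun g hg =>
    sum_range_mul_sub_mul_pow_of_pow_eq_one
      (fun h => (Finset.mem_filter.mp hg).2 (Units.ext h)) (hpow g)
  have heq : ∀ g ∈ Finset.univ.filter (fun g : Γ => ¬ χ g ≠ 1),
      ∑ k ∈ Finset.range n, (k : ℂ) * (n - k) * (χ g : ℂ) ^ k = (n : ℂ) * (n ^ 2 - 1) / 6 := by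
    intro g hg
    have h1 : χ g = 1 := not_not.mp (Finset.mem_filter.mp hg).2
    simp only [h1, Units.val_one, one_pow, mul_one, sum_range_mul_sub]
    ring
  rw [← Finset.sum_filter_add_sum_filter_not _ (fun g : Γ => χ g ≠ 1), Finset.sum_congr rfl hne,
    ← Finset.mul_sum, Finset.sum_congr rfl heq, Finset.sum_const, nsmul_eq_mul, hker] at hzero
  apply mul_left_cancel₀ (mul_ne_zero two_ne_zero hn0)
  linear_combination hzero
end

section
/- Let Γ be a nontrivial finite abelian group and χ₁, χ₂, χ₃ : Γ → ℂ* group homomorphisms such that χ₁(g)χ₂(g)χ₃(g) = 1 for all g ∈ Γ, such that ker χ₁ ∩ ker χ₂ ∩ ker χ₃ = {1}, and such that each χ_k is nontrivial. Set Γ⁰ := {g ∈ Γ \ {1} : χ₁(g) ≠ 1, χ₂(g) ≠ 1 and χ₃(g) ≠ 1}, and for k = 1, 2, 3 put n_k := |ker χ_k|, ν_k := |im χ_k|, δ_k(Γ) := Σ_{g ∈ Γ⁰} χ_k(g)/(1 − χ_k(g))² (so δ_k(Γ) = 0 when Γ⁰ = ∅), and ε_k(Γ) := δ_k(Γ)/|Γ|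 − (n_k − 1)(ν_k² − 1)/(12 ν_k). Then ε₁(Γ) = ε₂(Γ) = ε₃(Γ) = −( |Γ|² + 2 − (n₁² + n₂² + n₃²) ) / (12·|Γ|). -/
open scoped Classical

open Finset

theorem sum_range_natCast_mul_pow_mul_sub_one {R : Type*} [CommRing R] (n : ℕ) (z : R) :
    (∑ j ∈ range n, (j : R) * z ^ j) * (z - 1) = n * z ^ n - z * ∑ j ∈ range n, z ^ j := by
  induction n with
  | zero => simp
  | succ n ih =>
    rw [sum_range_succ, sum_range_succ, add_mul, ih]
    push_cast
    ring

theorem sum_range_natCast_mul_pow_of_pow_eq_one {z : ℂ} {n : ℕ} (hz : z ^ n = 1) (h1 : z ≠ 1) :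
    ∑ j ∈ range n, (j : ℂ) * z ^ j = n / (z - 1) := by
  have h : ∑ j ∈ range n, z ^ j = 0 := by
    rw [geom_sum_eq h1, hz, sub_self, zero_div]
  rw [eq_div_iff (sub_ne_zero.2 h1), sum_range_natCast_mul_pow_mul_sub_one, hz, h]
  ring

theorem sum_range_natCast_eq (n : ℕ) :
    ∑ j ∈ range n, (j : ℂ) = n * (n - 1) / 2 := by
  induction n with
  | zero => simp
  | succ n ih => rw [sum_range_succ, ih]; push_cast; ring

theorem sum_range_natCast_sq_eq (n : ℕ) :
    ∑ j ∈ range n, (j : ℂ) ^ 2 = n * (n - 1) * (2 * n - 1) / 6 := by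
  induction n with
  | zero => simp
  | succ n ih => rw [sum_range_succ, ih]; push_cast; ring

/-- Orthogonality of the powers of a faithful linear character. -/
theorem sum_pow_mul_inv_pow_of_injective {G : Type*} [CommGroup G] [Fintype G] (ψ : G →* ℂˣ)
    (hψ : Function.Injective ψ) {j l : ℕ} (hj : j < Fintype.card G) (hl : l < Fintype.card G) :
    ∑ g, (ψ g : ℂ) ^ j * ((ψ g : ℂ)⁻¹) ^ l = if j = l then (Fintype.card G : ℂ) else 0 := by
  split_ifs with h
  · subst h
    simp
  · have hc : IsCyclic G := isCyclic_of_injective_ringHom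
      ((Units.coeHom ℂ).comp ψ) (Units.val_injective.comp hψ)
    obtain ⟨x, hx⟩ := hc.exists_generator
    have hne : (Units.coeHom ℂ).comp (ψ ^ j * (ψ ^ l)⁻¹) ≠ 1 := by
      intro h1
      have h2 : (ψ x) ^ j * ((ψ x) ^ l)⁻¹ = 1 := Units.ext (DFunLike.congr_fun h1 x)
      rw [mul_inv_eq_one, ← map_pow, ← map_pow] at h2
      have ho := orderOf_eq_card_of_forall_mem_zpowers hx
      rw [Nat.card_eq_fintype_card] at ho
      exact h (pow_injOn_Iio_orderOf (by simpa [ho] using hj) (by simpa [ho] using hl) (hψ h2))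
    simpa using sum_hom_units_eq_zero _ hne

theorem sum_div_one_sub_sq_of_injective {G : Type*} [CommGroup G] [Fintype G] (ψ : G →* ℂˣ)
    (hψ : Function.Injective ψ) :
    ∑ g, (ψ g : ℂ) / (1 - (ψ g : ℂ)) ^ 2 = -((Fintype.card G : ℂ) ^ 2 - 1) / 12 := by
  set n := Fintype.card G with hn
  have hn0 : (n : ℂ) ≠ 0 := by simp [hn]
  have key : ∑ g, (∑ j ∈ range n, (j : ℂ) * (ψ g : ℂ) ^ j) *
      (∑ l ∈ range n, (l : ℂ) * ((ψ g : ℂ)⁻¹) ^ l) = n * ∑ j ∈ range n, (j : ℂ) ^ 2 := by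
    simp_rw [sum_mul_sum]
    rw [sum_comm, mul_sum]
    refine sum_congr rfl fun j hj => ?_
    rw [sum_comm]
    have : ∀ l ∈ range n, ∑ g, ((j : ℂ) * (ψ g : ℂ) ^ j) * ((l : ℂ) * ((ψ g : ℂ)⁻¹) ^ l) =
        if j = l then (n : ℂ) * j ^ 2 else 0 := by
      intro l hl
      have h := sum_pow_mul_inv_pow_of_injective ψ hψ (mem_range.1 hj) (mem_range.1 hl)
      calc _ = (j : ℂ) * l * ∑ g, (ψ g : ℂ) ^ j * ((ψ g : ℂ)⁻¹) ^ l := by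
            rw [mul_sum]; exact sum_congr rfl fun g _ => by ring
        _ = _ := by
          rw [h]
          split_ifs with h'
          · subst h'; ring
          · ring
    rw [sum_congr rfl this, sum_ite_eq, if_pos hj]
  have term : ∀ g, (∑ j ∈ range n, (j : ℂ) * (ψ g : ℂ) ^ j) *
      (∑ l ∈ range n, (l : ℂ) * ((ψ g : ℂ)⁻¹) ^ l) =
      (if g = 1 then ((n : ℂ) * (n - 1) / 2) ^ 2 else 0) -
        n ^ 2 * ((ψ g : ℂ) / (1 - (ψ g : ℂ)) ^ 2) := by
    intro g
    split_ifs with h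
    · subst h
      simp [sum_range_natCast_eq]
      ring
    · have h1 : (ψ g : ℂ) ≠ 1 := fun h2 =>
        h (hψ (by rw [map_one]; exact Units.ext h2))
      have hp : (ψ g : ℂ) ^ n = 1 := by
        rw [← Units.val_pow_eq_pow_val, ← map_pow, hn, pow_card_eq_one, map_one, Units.val_one]
      have h0 : (ψ g : ℂ) ≠ 0 := (ψ g).ne_zero
      rw [sum_range_natCast_mul_pow_of_pow_eq_one hp h1,
        sum_range_natCast_mul_pow_of_pow_eq_one (by rw [inv_pow, hp, inv_one])
          (by simpa using h1)]
      have h2 : (ψ g : ℂ) - 1 ≠ 0 := sub_ne_zero.2 h1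
      have h3 : 1 - (ψ g : ℂ) ≠ 0 := sub_ne_zero.2 h1.symm
      have h4 : (ψ g : ℂ)⁻¹ - 1 = (1 - (ψ g : ℂ)) / ψ g := by field_simp
      rw [h4, ← neg_sub (1 : ℂ) (ψ g)]
      field_simp
      ring
  rw [sum_congr rfl fun g _ => term g, sum_sub_distrib, sum_ite_eq', if_pos (mem_univ _),
    ← mul_sum, sum_range_natCast_sq_eq] at key
  refine mul_left_cancel₀ (pow_ne_zero 2 hn0) ?_
  linear_combination -key

theorem sum_div_one_sub_sq {G : Type*} [CommGroup G] [Fintype G] (ψ : G →* ℂˣ) :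
    ∑ g, (ψ g : ℂ) / (1 - (ψ g : ℂ)) ^ 2 =
      Nat.card ψ.ker * (-((Nat.card ψ.range : ℂ) ^ 2 - 1) / 12) := by
  have hf : ∀ x : ψ.range, #{g | ψ.rangeRestrict g = x} = Nat.card ψ.ker := by
    intro x
    rw [MonoidHom.card_fiber_eq_of_mem_range ψ.rangeRestrict
      (x := x) (y := 1) (ψ.rangeRestrict_surjective x) ⟨1, map_one _⟩,
      Nat.card_eq_fintype_card, Fintype.card_subtype]
    congr 1
    ext g
    simp [Subtype.ext_iff, MonoidHom.mem_ker]
  have h := sum_div_one_sub_sq_of_injective ψ.range.subtype ψ.range.subtype_injective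
  rw [Nat.card_eq_fintype_card (α := ψ.range), ← h, mul_sum,
    ← sum_fiberwise univ ψ.rangeRestrict]
  refine sum_congr rfl fun x _ => ?_
  rw [sum_congr rfl (g := fun _ => ((x : ℂˣ) : ℂ) / (1 - ((x : ℂˣ) : ℂ)) ^ 2), sum_const, hf, nsmul_eq_mul]
  · rfl
  · intro g hg
    rw [← (mem_filter.1 hg).2]
    rfl

theorem sum_filter_ker_div_one_sub_sq {G : Type*} [CommGroup G] [Fintype G] (a b : G →* ℂˣ)
    (h : ∀ g, a g = 1 → b g = 1 → g = 1) :
    ∑ g with b g = 1, (a g : ℂ) / (1 - (a g : ℂ)) ^ 2 =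
      -((Nat.card b.ker : ℂ) ^ 2 - 1) / 12 := by
  have hinj : Function.Injective (a.comp b.ker.subtype) := by
    rw [injective_iff_map_eq_one]
    exact fun g hg => Subtype.ext (h g hg g.2)
  have := sum_div_one_sub_sq_of_injective _ hinj
  rw [Nat.card_eq_fintype_card, ← this]
  exact sum_subtype _ (by simp [MonoidHom.mem_ker])
    (fun g : G => (a g : ℂ) / (1 - (a g : ℂ)) ^ 2)

theorem sum_div_one_sub_sq_isolated {G : Type*} [CommGroup G] [Fintype G] (a b c : G →* ℂˣ)
    (hab : ∀ g, a g = 1 → b g = 1 → g = 1) (hac : ∀ g, a g = 1 → c g = 1 → g = 1)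
    (hbc : ∀ g, b g = 1 → c g = 1 → g = 1) :
    (∑ g with a g ≠ 1 ∧ b g ≠ 1 ∧ c g ≠ 1, (a g : ℂ) / (1 - (a g : ℂ)) ^ 2) /
          (Fintype.card G : ℂ) -
        ((Nat.card a.ker : ℂ) - 1) * ((Nat.card a.range : ℂ) ^ 2 - 1) /
          (12 * (Nat.card a.range : ℂ)) =
      -((Fintype.card G : ℂ) ^ 2 + 2 - ((Nat.card a.ker : ℂ) ^ 2 + (Nat.card b.ker : ℂ) ^ 2 +
        (Nat.card c.ker : ℂ) ^ 2)) / (12 * (Fintype.card G : ℂ)) := by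
  have hsum : ∑ g with a g ≠ 1 ∧ b g ≠ 1 ∧ c g ≠ 1, (a g : ℂ) / (1 - (a g : ℂ)) ^ 2 =
      ∑ g, (a g : ℂ) / (1 - (a g : ℂ)) ^ 2 -
        ∑ g with b g = 1, (a g : ℂ) / (1 - (a g : ℂ)) ^ 2 -
        ∑ g with c g = 1, (a g : ℂ) / (1 - (a g : ℂ)) ^ 2 := by
    simp only [sum_filter]
    rw [← sum_sub_distrib, ← sum_sub_distrib]
    refine sum_congr rfl fun g _ => ?_
    by_cases ha : a g = 1
    · simp [ha]
    · have : ¬(b g = 1 ∧ c g = 1) := fun ⟨h1, h2⟩ => ha (by rw [hbc g h1 h2, map_one])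
      by_cases hb : b g = 1 <;> by_cases hc : c g = 1 <;> simp_all
  rw [hsum, sum_div_one_sub_sq, sum_filter_ker_div_one_sub_sq a b hab,
    sum_filter_ker_div_one_sub_sq a c hac]
  have hcard : (Fintype.card G : ℂ) = Nat.card a.ker * Nat.card a.range := by
    rw [← Nat.cast_mul, ← Subgroup.index_ker, Subgroup.card_mul_index, Nat.card_eq_fintype_card]
  have h1 : (Nat.card a.ker : ℂ) ≠ 0 := Nat.cast_ne_zero.2 Nat.card_pos.ne'
  have h2 : (Nat.card a.range : ℂ) ≠ 0 := Nat.cast_ne_zero.2 Nat.card_pos.ne'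
  rw [hcard]
  field_simp
  ring

/-- The invariant `ε(Γ)` of a finite abelian subgroup of `SL(3,ℂ)`: the three quantities
`ε_k(Γ) = δ_k(Γ)/|Γ| - (n_k - 1)(ν_k² - 1)/(12ν_k)` coincide and equal
`-(|Γ|² + 2 - (n₁² + n₂² + n₃²))/(12|Γ|)`. -/
theorem epsilon_k_eval (Γ : Type*) [CommGroup Γ] [Fintype Γ] [Nontrivial Γ]
    (χ : Fin 3 → (Γ →* ℂˣ))
    (hprod : ∀ g : Γ, χ 0 g * χ 1 g * χ 2 g = 1)
    (hker : (χ 0).ker ⊓ (χ 1).ker ⊓ (χ 2).ker = ⊥)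
    (hnt : ∀ k : Fin 3, χ k ≠ 1) :
    ∀ k : Fin 3,
      (∑ g ∈ Finset.univ.filter (fun g : Γ => g ≠ 1 ∧ ∀ j : Fin 3, χ j g ≠ 1),
            (χ k g : ℂ) / (1 - (χ k g : ℂ)) ^ 2) / (Fintype.card Γ : ℂ) -
          ((Nat.card (MonoidHom.ker (χ k)) : ℂ) - 1) *
            ((Nat.card (MonoidHom.range (χ k)) : ℂ) ^ 2 - 1) /
              (12 * (Nat.card (MonoidHom.range (χ k)) : ℂ))
        = -((Fintype.card Γ : ℂ) ^ 2 + 2 -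
              ((Nat.card (MonoidHom.ker (χ 0)) : ℂ) ^ 2 +
                (Nat.card (MonoidHom.ker (χ 1)) : ℂ) ^ 2 +
                (Nat.card (MonoidHom.ker (χ 2)) : ℂ) ^ 2)) /
            (12 * (Fintype.card Γ : ℂ)) := by
  have hall : ∀ g, χ 0 g = 1 → χ 1 g = 1 → χ 2 g = 1 → g = 1 := fun g h0 h1 h2 => by
    rw [← Subgroup.mem_bot, ← hker]
    exact ⟨⟨h0, h1⟩, h2⟩
  have h01 : ∀ g, χ 0 g = 1 → χ 1 g = 1 → g = 1 := fun g h0 h1 =>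
    hall g h0 h1 (by simpa [h0, h1] using hprod g)
  have h02 : ∀ g, χ 0 g = 1 → χ 2 g = 1 → g = 1 := fun g h0 h2 =>
    hall g h0 (by simpa [h0, h2] using hprod g) h2
  have h12 : ∀ g, χ 1 g = 1 → χ 2 g = 1 → g = 1 := fun g h1 h2 =>
    hall g (by simpa [h1, h2] using hprod g) h1 h2
  have hne : ∀ g, (g ≠ 1 ∧ ∀ j : Fin 3, χ j g ≠ 1) ↔ χ 0 g ≠ 1 ∧ χ 1 g ≠ 1 ∧ χ 2 g ≠ 1 := by
    intro g
    simp only [Fin.forall_fin_succ, IsEmpty.forall_iff, and_true]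
    exact ⟨fun h => h.2, fun h => ⟨fun h1 => h.1 (by rw [h1, map_one]), h⟩⟩
  simp only [hne]
  refine Fin.forall_fin_succ.2 ⟨?_, Fin.forall_fin_succ.2 ⟨?_, Fin.forall_fin_one.2 ?_⟩⟩
  · exact sum_div_one_sub_sq_isolated _ _ _ h01 h02 h12
  · have h := sum_div_one_sub_sq_isolated (χ 1) (χ 0) (χ 2) (fun g h1 h0 => h01 g h0 h1) h12 h02
    rw [add_comm ((Nat.card (χ 1).ker : ℂ) ^ 2)] at h
    have hr : ∀ g, (χ 1 g ≠ 1 ∧ χ 0 g ≠ 1 ∧ χ 2 g ≠ 1) ↔ χ 0 g ≠ 1 ∧ χ 1 g ≠ 1 ∧ χ 2 g ≠ 1 :=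
      fun g => and_left_comm
    simp only [hr] at h
    exact h
  · have h := sum_div_one_sub_sq_isolated (χ 2) (χ 0) (χ 1) (fun g h2 h0 => h02 g h0 h2)
      (fun g h2 h1 => h12 g h1 h2) h01
    rw [add_assoc, add_comm ((Nat.card (χ 2).ker : ℂ) ^ 2)] at h
    have hr : ∀ g, (χ 2 g ≠ 1 ∧ χ 0 g ≠ 1 ∧ χ 1 g ≠ 1) ↔ χ 0 g ≠ 1 ∧ χ 1 g ≠ 1 ∧ χ 2 g ≠ 1 :=
      fun g => and_rotate
    simp only [hr] at h
    exact h
end
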